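/- Value at the origin and a ball inside the solvability set: H̄_∞(0) = σ̄ m₀. Moreover, if σ̄ m₀ < σ̲, then 0 ∈ D and the open ball B(0, (σ̲ − σ̄ m₀)/(σ̄ L)) is contained in D, where L is the Lipschitz constant of m. -/

import Mathlib

open Set Filter MeasureTheory

noncomputable section

abbrev Euc (N : ℕ) := EuclideanSpace ℝ (Fin N)

def intVec {N : ℕ} (z : Fin N → ℤ) : Euc N :=
  (EuclideanSpace.equiv (Fin N) ℝ).symm (fun i => (z i : ℝ))

def IsZPeriodic {N : ℕ} (u : Euc N → ℝ) : Prop :=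
  ∀ (x : Euc N) (z : Fin N → ℤ), u (x + intVec z) = u x

def IsZPeriodicH {N : ℕ} (H : Euc N → Euc N → ℝ) : Prop :=
  ∀ (x p : Euc N) (z : Fin N → ℤ), H (x + intVec z) p = H x p

def superDiff {N : ℕ} (u : Euc N → ℝ) (x : Euc N) : Set (Euc N) :=
  { q | ∃ φ : Euc N → ℝ, ContDiff ℝ 1 φ ∧ IsZPeriodic φ ∧
        (∀ y, u y - φ y ≤ u x - φ x) ∧ q = gradient φ x }

def subDiff {N : ℕ} (u : Euc N → ℝ) (x : Euc N) : Set (Euc N) :=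
  { q | ∃ φ : Euc N → ℝ, ContDiff ℝ 1 φ ∧ IsZPeriodic φ ∧
        (∀ y, u x - φ x ≤ u y - φ y) ∧ q = gradient φ x }

def IsCellSubsolution {N : ℕ} (H : Euc N → Euc N → ℝ) (P : Euc N) (a : ℝ) (u : Euc N → ℝ) : Prop :=
  ∀ x, ∀ q ∈ superDiff u x, H x (q + P) ≤ a

def IsCellSupersolution {N : ℕ} (H : Euc N → Euc N → ℝ) (P : Euc N) (a : ℝ) (u : Euc N → ℝ) : Prop :=
  ∀ x, ∀ q ∈ subDiff u x, a ≤ H x (q + P)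

def IsCellSolution {N : ℕ} (H : Euc N → Euc N → ℝ) (P : Euc N) (u : Euc N → ℝ) (a : ℝ) : Prop :=
  (∃ K : NNReal, LipschitzWith K u) ∧ IsZPeriodic u ∧
    IsCellSubsolution H P a u ∧ IsCellSupersolution H P a u

def IsCoerciveH {N : ℕ} (H : Euc N → Euc N → ℝ) : Prop :=
  ∀ C : ℝ, ∃ r : ℝ, ∀ x p : Euc N, r ≤ ‖p‖ → C ≤ H x p

lemma intVec_apply {N : ℕ} (z : Fin N → ℤ) (i : Fin N) : intVec z i = (z i : ℝ) := rfl

/-- A continuous periodic function attains its maximum. -/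
lemma IsZPeriodic.exists_forall_le {N : ℕ} {f : Euc N → ℝ} (hf : IsZPeriodic f)
    (hc : Continuous f) : ∃ x, ∀ y, f y ≤ f x := by
  have hK : IsCompact ((EuclideanSpace.equiv (Fin N) ℝ).symm ''
      (Set.pi univ fun _ => Set.Icc (0 : ℝ) 1)) :=
    (isCompact_univ_pi fun _ => isCompact_Icc).image
      (EuclideanSpace.equiv (Fin N) ℝ).symm.continuous
  obtain ⟨x, -, hx⟩ := hK.exists_isMaxOn
    ⟨_, Set.mem_image_of_mem _ (fun _ _ => ⟨le_refl 0, zero_le_one⟩)⟩ hc.continuousOn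
  refine ⟨x, fun y => ?_⟩
  rw [← hf y (fun i => -⌊y i⌋)]
  refine hx ⟨fun i => Int.fract (y i),
    fun i _ => ⟨Int.fract_nonneg _, (Int.fract_lt_one _).le⟩, ?_⟩
  ext i
  simp [intVec_apply, Int.fract, sub_eq_add_neg]

/-- A continuous periodic function attains its minimum. -/
lemma IsZPeriodic.exists_forall_ge {N : ℕ} {f : Euc N → ℝ} (hf : IsZPeriodic f)
    (hc : Continuous f) : ∃ x, ∀ y, f x ≤ f y := by
  obtain ⟨x, hx⟩ := IsZPeriodic.exists_forall_le (f := fun y => -f y)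
    (fun y z => by simp [hf y z]) hc.neg
  exact ⟨x, fun y => by simpa using hx y⟩

/-- A smooth periodic function vanishing exactly on the integer lattice. -/
def latticePenalty {N : ℕ} (w : Euc N) : ℝ := ∑ i, (1 - Real.cos (2 * Real.pi * w i))

/-- The gradient of `latticePenalty`. -/
def latticePenaltyGrad {N : ℕ} (w : Euc N) : Euc N :=
  WithLp.toLp 2 fun i => 2 * Real.pi * Real.sin (2 * Real.pi * w i)

lemma latticePenalty_nonneg {N : ℕ} (w : Euc N) : 0 ≤ latticePenalty w :=
  Finset.sum_nonneg fun i _ => by linarith [Real.cos_le_one (2 * Real.pi * w i)]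

lemma latticePenalty_zero {N : ℕ} : latticePenalty (0 : Euc N) = 0 := by
  simp [latticePenalty]

lemma latticePenalty_periodic {N : ℕ} : IsZPeriodic (latticePenalty (N := N)) := by
  intro x z
  refine Finset.sum_congr rfl fun i _ => ?_
  have h : 2 * Real.pi * (x + intVec z) i
      = 2 * Real.pi * x i + (z i : ℝ) * (2 * Real.pi) := by
    rw [PiLp.add_apply, intVec_apply]; ring
  rw [h, Real.cos_add_int_mul_two_pi]

lemma contDiff_latticePenalty {N : ℕ} : ContDiff ℝ 1 (latticePenalty (N := N)) := by
  unfold latticePenalty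
  fun_prop

lemma abs_cos_add_sub_le (a b : ℝ) :
    |Real.cos (a + b) - Real.cos a + b * Real.sin a| ≤ b ^ 2 := by
  have hd : ∀ t ∈ Set.Icc (-|b|) |b|,
      HasDerivWithinAt (fun t => Real.cos (a + t) + t * Real.sin a)
        (-Real.sin (a + t) + Real.sin a) (Set.Icc (-|b|) |b|) t := by
    intro t _
    have h1 : HasDerivAt (fun t => Real.cos (a + t)) (-Real.sin (a + t) * 1) t :=
      (Real.hasDerivAt_cos (a + t)).comp t ((hasDerivAt_id t).const_add a)
    have h2 := h1.add ((hasDerivAt_id t).mul_const (Real.sin a))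
    rw [mul_one, one_mul] at h2
    exact h2.hasDerivWithinAt
  have hb : ∀ t ∈ Set.Icc (-|b|) |b|, ‖-Real.sin (a + t) + Real.sin a‖ ≤ |b| := by
    intro t ht
    have h := Real.abs_sin_sub_sin_le a (a + t)
    rw [Real.norm_eq_abs, neg_add_eq_sub]
    refine h.trans ?_
    rw [sub_add_cancel_left, abs_neg]
    exact abs_le.2 ht
  have := (convex_Icc (-|b|) |b|).norm_image_sub_le_of_norm_hasDerivWithin_le hd hb
    (show (0 : ℝ) ∈ _ from ⟨by simp, abs_nonneg b⟩) (show b ∈ _ from abs_le.1 le_rfl)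
  simp only [Real.norm_eq_abs, sub_zero, add_zero, zero_mul, abs_mul_abs_self] at this
  calc _ = |Real.cos (a + b) + b * Real.sin a - Real.cos a| := by congr 1; ring
    _ ≤ _ := by rw [sq]; exact this

lemma latticePenalty_taylor {N : ℕ} (w h : Euc N) :
    |latticePenalty (w + h) - latticePenalty w - inner ℝ (latticePenaltyGrad w) h|
      ≤ (2 * Real.pi) ^ 2 * ‖h‖ ^ 2 := by
  rw [EuclideanSpace.norm_sq_eq, Finset.mul_sum, PiLp.inner_apply]
  unfold latticePenalty latticePenaltyGrad
  rw [← Finset.sum_sub_distrib, ← Finset.sum_sub_distrib]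
  refine (Finset.abs_sum_le_sum_abs _ _).trans (Finset.sum_le_sum fun i _ => ?_)
  have := abs_cos_add_sub_le (2 * Real.pi * w i) (2 * Real.pi * h i)
  rw [← abs_neg] at this
  simp only [PiLp.add_apply, Real.norm_eq_abs, sq_abs, RCLike.inner_apply, conj_trivial]
  calc _ = _ := by congr 1; rw [mul_add]; ring
    _ ≤ _ := this
    _ = _ := by ring

lemma hasFDerivAt_latticePenalty {N : ℕ} (w : Euc N) :
    HasFDerivAt latticePenalty (innerSL ℝ (latticePenaltyGrad w)) w := by
  rw [hasFDerivAt_iff_isLittleO_nhds_zero]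
  refine Asymptotics.IsBigO.trans_isLittleO (g := fun h : Euc N => ‖h‖ ^ 2) ?_
    (Asymptotics.isLittleO_norm_pow_id one_lt_two)
  refine Asymptotics.IsBigO.of_bound ((2 * Real.pi) ^ 2) (Eventually.of_forall fun h => ?_)
  simpa using latticePenalty_taylor w h

/-- At a maximum point of `u - k * latticePenalty (· - x)`, the gradient of the penalty lies in
the superdifferential of `u`. -/
lemma mem_superDiff_of_penalty {N : ℕ} {u : Euc N → ℝ} {k : ℝ} {x y : Euc N}
    (hy : ∀ z, u z - k * latticePenalty (z - x) ≤ u y - k * latticePenalty (y - x)) :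
    k • latticePenaltyGrad (y - x) ∈ superDiff u y := by
  refine ⟨fun z => k * latticePenalty (z - x), ?_, ?_, hy, ?_⟩
  · exact contDiff_const.mul (contDiff_latticePenalty.comp (contDiff_id.sub contDiff_const))
  · intro z n
    simp only
    rw [add_sub_right_comm, latticePenalty_periodic]
  · have h : HasGradientAt (fun z => k * latticePenalty (z - x))
        (k • latticePenaltyGrad (y - x)) y := by
      rw [hasGradientAt_iff_hasFDerivAt, map_smul]
      exact ((hasFDerivAt_comp_sub x).2 (hasFDerivAt_latticePenalty _)).const_mul k
    exact h.gradient.symm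

lemma exists_penalty_max {N : ℕ} {u : Euc N → ℝ} (hu : IsZPeriodic u) (hc : Continuous u)
    (k : ℝ) (x : Euc N) :
    ∃ y, ∀ z, u z - k * latticePenalty (z - x) ≤ u y - k * latticePenalty (y - x) := by
  refine IsZPeriodic.exists_forall_le (f := fun z => u z - k * latticePenalty (z - x)) ?_ ?_
  · intro z n
    simp only
    rw [add_sub_right_comm, latticePenalty_periodic, hu]
  · exact hc.sub (continuous_const.mul
      (contDiff_latticePenalty.continuous.comp (continuous_id.sub continuous_const)))

/-- A small penalty forces the values of a continuous periodic function to be close. -/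
lemma IsZPeriodic.exists_penalty_lt {N : ℕ} {f : Euc N → ℝ} (hf : IsZPeriodic f)
    (hc : Continuous f) (x : Euc N) {ε : ℝ} (hε : 0 < ε) :
    ∃ δ > 0, ∀ y, latticePenalty (y - x) < δ → |f y - f x| < ε := by
  obtain ⟨η, hη, h⟩ := Metric.continuous_iff.1 hc x ε hε
  refine ⟨8 * η ^ 2, by positivity, fun y hy => ?_⟩
  set z : Fin N → ℤ := fun i => -round ((y - x) i) with hz
  have hle : 8 * ‖y + intVec z - x‖ ^ 2 ≤ latticePenalty (y - x) := by
    rw [← latticePenalty_periodic (y - x) z, add_sub_right_comm, EuclideanSpace.norm_sq_eq,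
      Finset.mul_sum]
    refine Finset.sum_le_sum fun i _ => ?_
    have h1 : |(y - x + intVec z) i| ≤ 1 / 2 := by
      have := abs_sub_round ((y - x) i)
      rw [PiLp.add_apply, intVec_apply, hz]
      push_cast
      rwa [← sub_eq_add_neg]
    set s := (y - x + intVec z) i
    have h2 := Real.cos_le_one_sub_mul_cos_sq (x := 2 * Real.pi * s) (by
      rw [abs_mul, abs_of_pos Real.two_pi_pos]
      nlinarith [Real.pi_pos])
    have h3 : 2 / Real.pi ^ 2 * (2 * Real.pi * s) ^ 2 = 8 * s ^ 2 := by
      field_simp [Real.pi_ne_zero]; ring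
    rw [Real.norm_eq_abs, sq_abs]
    linarith
  have hlt : ‖y + intVec z - x‖ < η := by
    refine lt_of_pow_lt_pow_left₀ 2 hη.le ?_
    linarith
  have := h (y + intVec z) (by rwa [dist_eq_norm])
  rwa [hf, Real.dist_eq] at this

/-- Maximum points of `u - k * latticePenalty (· - x)` have small penalty once `k` is large. -/
lemma exists_penalty_max_lt {N : ℕ} {u : Euc N → ℝ} (hu : IsZPeriodic u) (hc : Continuous u)
    (x : Euc N) {δ : ℝ} (hδ : 0 < δ) :
    ∃ k : ℝ, 0 < k ∧ ∀ y,
      (∀ z, u z - k * latticePenalty (z - x) ≤ u y - k * latticePenalty (y - x)) →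
      latticePenalty (y - x) < δ := by
  obtain ⟨M, hM⟩ := hu.exists_forall_le hc
  have h0 : 0 ≤ u M - u x := sub_nonneg.2 (hM x)
  refine ⟨(u M - u x + 1) / δ, by positivity, fun y hy => ?_⟩
  have h1 := hy x
  rw [sub_self, latticePenalty_zero, mul_zero, sub_zero] at h1
  by_contra! h2
  have h3 : (u M - u x + 1) / δ * δ ≤ (u M - u x + 1) / δ * latticePenalty (y - x) :=
    mul_le_mul_of_nonneg_left h2 (by positivity)
  rw [div_mul_cancel₀ _ hδ.ne'] at h3
  linarith [hM y]

lemma sub_le_of_sub_le_add_sq {E : Type*} [NormedAddCommGroup E] [NormedSpace ℝ E]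
    {w : E → ℝ} {R C : ℝ} (h : ∀ x y, w x - w y ≤ R * ‖x - y‖ + C * ‖x - y‖ ^ 2) (x y : E) :
    w x - w y ≤ R * ‖x - y‖ := by
  have key : ∀ (n : ℕ) (e : E),
      w (y + (n : ℝ) • e) - w y ≤ n * (R * ‖e‖ + C * ‖e‖ ^ 2) := by
    intro n e
    induction n with
    | zero => simp
    | succ n ih =>
      have h1 := h (y + ((n + 1 : ℕ) : ℝ) • e) (y + (n : ℝ) • e)
      have h2 : y + ((n + 1 : ℕ) : ℝ) • e - (y + (n : ℝ) • e) = e := by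
        push_cast; module
      rw [h2] at h1
      push_cast at h1 ⊢
      linarith
  have hn : ∀ n : ℕ, w x - w y ≤ R * ‖x - y‖ + C * ‖x - y‖ ^ 2 * (1 / ((n : ℝ) + 1)) := by
    intro n
    have hpos : (0 : ℝ) < (n : ℝ) + 1 := by positivity
    have h1 := key (n + 1) (((n : ℝ) + 1)⁻¹ • (x - y))
    push_cast at h1
    rw [smul_inv_smul₀ hpos.ne', add_sub_cancel, norm_smul, norm_inv, Real.norm_eq_abs,
      abs_of_pos hpos] at h1
    refine h1.trans_eq ?_
    field_simp
  have ht := (tendsto_one_div_add_atTop_nhds_zero_nat (𝕜 := ℝ)).const_mul (C * ‖x - y‖ ^ 2)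
  have ht2 := ht.const_add (R * ‖x - y‖)
  rw [mul_zero, add_zero] at ht2
  exact ge_of_tendsto' ht2 hn

/-- A viscosity gradient bound `|Du + P| ≤ R` is a genuine Lipschitz bound. -/
lemma sub_add_inner_le_of_superDiff {N : ℕ} {u : Euc N → ℝ} (hu : IsZPeriodic u)
    (hc : Continuous u) {P : Euc N} {R : ℝ} (hR : ∀ x, ∀ q ∈ superDiff u x, ‖q + P‖ ≤ R)
    (x y : Euc N) : u x - u y + inner ℝ P (x - y) ≤ R * ‖x - y‖ := by
  refine le_of_forall_pos_le_add fun ε hε => ?_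
  obtain ⟨δ, hδ, hclose⟩ := hu.exists_penalty_lt hc y hε
  obtain ⟨k, hk, hsmall⟩ := exists_penalty_max_lt hu hc y hδ
  choose Y hY using exists_penalty_max hu hc k
  set v : Euc N → ℝ := fun a => u (Y a) - k * latticePenalty (Y a - a) + inner ℝ P a with hv
  have hvLip := sub_le_of_sub_le_add_sq (w := v) (R := R) (C := k * (2 * Real.pi) ^ 2) (by
    intro a b
    have h1 := hY b (Y a)
    have h2 := (abs_le.1 (latticePenalty_taylor (Y a - a) (a - b))).2
    rw [sub_add_sub_cancel] at h2
    have h3 := mul_le_mul_of_nonneg_left h2 hk.le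
    have h4 : inner ℝ (k • latticePenaltyGrad (Y a - a) + P) (a - b) ≤ R * ‖a - b‖ :=
      (real_inner_le_norm _ _).trans (mul_le_mul_of_nonneg_right
        (hR _ _ (mem_superDiff_of_penalty (hY a))) (norm_nonneg _))
    rw [inner_add_left, real_inner_smul_left, inner_sub_right P] at h4
    simp only [hv]
    linarith) x y
  have h1 := hY x x
  rw [sub_self, latticePenalty_zero, mul_zero, sub_zero] at h1
  have h2 := (abs_lt.1 (hclose (Y y) (hsmall (Y y) (hY y)))).2
  have h3 : 0 ≤ k * latticePenalty (Y y - y) := mul_nonneg hk.le (latticePenalty_nonneg _)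
  rw [inner_sub_right]
  simp only [hv] at hvLip
  linarith

lemma norm_add_le_of_mem_subDiff {N : ℕ} {u : Euc N → ℝ} {P : Euc N} {R : ℝ} (hR : 0 ≤ R)
    (hLip : ∀ x y, u x - u y + inner ℝ P (x - y) ≤ R * ‖x - y‖) {x q : Euc N}
    (hq : q ∈ subDiff u x) : ‖q + P‖ ≤ R := by
  obtain ⟨φ, hφ, -, hmin, rfl⟩ := hq
  set e := gradient φ x + P with he
  have hd : HasDerivAt (fun t : ℝ => φ (x + t • e)) (inner ℝ (gradient φ x) e) 0 := by
    have h1 := ((hφ.differentiable one_ne_zero) x).hasGradientAt.hasFDerivAt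
    have h2 : HasDerivAt (fun t : ℝ => x + t • e) e 0 := by
      simpa using ((hasDerivAt_id (0 : ℝ)).smul_const e).const_add x
    have h3 := HasFDerivAt.comp_hasDerivAt_of_eq (0 : ℝ) h1 h2 (by simp)
    rwa [InnerProductSpace.toDual_apply_apply] at h3
  have hlim := hd.tendsto_slope_zero_right
  have hle : inner ℝ (gradient φ x) e ≤ R * ‖e‖ - inner ℝ P e := by
    refine le_of_tendsto hlim ?_
    filter_upwards [self_mem_nhdsWithin] with t ht
    have ht : 0 < t := ht
    have h1 := hmin (x + t • e)
    have h2 := hLip (x + t • e) x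
    rw [add_sub_cancel_left, inner_smul_right, norm_smul, Real.norm_eq_abs, abs_of_pos ht] at h2
    simp only [zero_add, zero_smul, add_zero, smul_eq_mul]
    rw [inv_mul_le_iff₀ ht]
    linarith
  have h4 : ‖e‖ * ‖e‖ ≤ R * ‖e‖ := by
    rw [← real_inner_self_eq_norm_mul_norm]
    nth_rewrite 1 [he]
    rw [inner_add_left]
    linarith
  rcases (norm_nonneg e).eq_or_lt with h0 | h0
  · rwa [← h0]
  · exact le_of_mul_le_mul_right h4 h0

lemma zero_mem_subDiff {N : ℕ} {u : Euc N → ℝ} {x : Euc N} (hx : ∀ y, u x ≤ u y) :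
    (0 : Euc N) ∈ subDiff u x :=
  ⟨fun _ => 0, contDiff_const, fun _ _ => rfl, by simpa using hx, by simp [gradient_fun_const]⟩

/-- The critical value is bounded by the Hamiltonian at a minimum point of the solution. -/
lemma IsCellSolution.exists_le {N : ℕ} {H : Euc N → Euc N → ℝ} {P : Euc N} {u : Euc N → ℝ}
    {a : ℝ} (h : IsCellSolution H P u a) : ∃ x, a ≤ H x P := by
  obtain ⟨⟨K, hK⟩, hp, -, hsup⟩ := h
  obtain ⟨x, hx⟩ := hp.exists_forall_ge hK.continuous
  exact ⟨x, by simpa using hsup x 0 (zero_mem_subDiff hx)⟩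

/-- A continuous periodic lower bound of the Hamiltonian bounds the critical value from below. -/
lemma IsCellSolution.le_of_forall_le {N : ℕ} {H : Euc N → Euc N → ℝ} {P : Euc N} {u : Euc N → ℝ}
    {a : ℝ} (h : IsCellSolution H P u a) {f : Euc N → ℝ} (hf : IsZPeriodic f)
    (hfc : Continuous f) (hle : ∀ x p, f x ≤ H x p) (x : Euc N) : f x ≤ a := by
  obtain ⟨⟨K, hK⟩, hp, hsub, -⟩ := h
  refine le_of_forall_pos_le_add fun ε hε => ?_
  obtain ⟨δ, hδ, hclose⟩ := hf.exists_penalty_lt hfc x hε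
  obtain ⟨k, -, hsmall⟩ := exists_penalty_max_lt hp hK.continuous x hδ
  obtain ⟨y, hy⟩ := exists_penalty_max hp hK.continuous k x
  have h1 := hsub y _ (mem_superDiff_of_penalty hy)
  have h2 := (abs_lt.1 (hclose y (hsmall y hy))).1
  linarith [hle y (k • latticePenaltyGrad (y - x) + P)]

/-- If the gradients of a solution are a priori bounded in the superdifferential sense, it also
solves any cell problem whose Hamiltonian coincides with the given one for such gradients. -/
lemma IsCellSolution.congr_of_superDiff {N : ℕ} {H H' : Euc N → Euc N → ℝ} {P : Euc N}
    {u : Euc N → ℝ} {a R : ℝ} (h : IsCellSolution H P u a) (hR0 : 0 ≤ R)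
    (hR : ∀ x, ∀ q ∈ superDiff u x, ‖q + P‖ ≤ R)
    (hH : ∀ x p, ‖p‖ ≤ R → H' x p = H x p) : IsCellSolution H' P u a := by
  obtain ⟨⟨K, hK⟩, hp, hsub, hsup⟩ := h
  have hLip := sub_add_inner_le_of_superDiff hp hK.continuous hR
  refine ⟨⟨K, hK⟩, hp, fun x q hq => ?_, fun x q hq => ?_⟩
  · rw [hH _ _ (hR x q hq)]
    exact hsub x q hq
  · rw [hH _ _ (norm_add_le_of_mem_subDiff hR0 hLip hq)]
    exact hsup x q hq

/-- Solvability of the cell problem when the linear upper bound on the critical value stays below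
the supremum of the Hamiltonian at every point. -/
lemma exists_isCellSolution_of_lt {N : ℕ} {σ : Euc N → ℝ} {m : ℝ → ℝ} {L : NNReal}
    (hσpos : ∀ x, 0 < σ x) (hmpos : ∀ r, 0 ≤ r → 0 < m r)
    (hmLip : LipschitzOnWith L m (Set.Ici 0)) (hmlim : Tendsto m atTop (nhds 1))
    {σmax σmin : ℝ} (hσmax : ∀ x, σ x ≤ σmax) (hσmin : IsLeast (Set.range σ) σmin)
    {c : ℕ → ℝ} {P : Euc N}
    (hc : ∀ n : ℕ, ∃ u : Euc N → ℝ,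
        IsCellSolution (fun x p => σ x * max (m ‖p‖) ((L : ℝ) * ‖p‖ - n)) P u (c n))
    (hP : σmax * (m 0 + L * ‖P‖) < σmin) :
    ∃ (u : Euc N → ℝ) (a : ℝ), IsCellSolution (fun x p => σ x * m ‖p‖) P u a := by
  have hσminpos : 0 < σmin := by
    obtain ⟨x, rfl⟩ := hσmin.1
    exact hσpos x
  have hm0 : 0 < m 0 := hmpos 0 le_rfl
  have hmP : m ‖P‖ ≤ m 0 + L * ‖P‖ := by
    have := hmLip.le_add_mul (x := ‖P‖) (norm_nonneg P) (y := 0) (le_refl (0 : ℝ))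
    simpa using this
  have hLP : 0 ≤ (L : ℝ) * ‖P‖ := by positivity
  have hcle : ∀ n, c n ≤ σmax * (m 0 + L * ‖P‖) := by
    intro n
    obtain ⟨u, hu⟩ := hc n
    obtain ⟨x, hx⟩ := hu.exists_le
    refine hx.trans (mul_le_mul (hσmax x) (max_le hmP ?_) ?_ ((hσpos x).le.trans (hσmax x)))
    · linarith [(Nat.cast_nonneg n : (0 : ℝ) ≤ n)]
    · exact (hmpos _ (norm_nonneg P)).le.trans (le_max_left _ _)
  obtain ⟨R, hR⟩ := eventually_atTop.1
    (hmlim.eventually (lt_mem_nhds ((div_lt_one hσminpos).2 hP)))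
  obtain ⟨n, hn⟩ := exists_nat_ge ((L : ℝ) * max R 0)
  obtain ⟨u, hu⟩ := hc n
  refine ⟨u, c n, hu.congr_of_superDiff (le_max_right R 0) (fun x q hq => ?_) fun x p hp => ?_⟩
  · by_contra! hlt
    have h1 := hR ‖q + P‖ ((le_max_left _ _).trans hlt.le)
    rw [div_lt_iff₀ hσminpos] at h1
    have h2 : σ x * max (m ‖q + P‖) ((L : ℝ) * ‖q + P‖ - n) ≤ c n := hu.2.2.1 x q hq
    have h3 : σmin * m ‖q + P‖ ≤ σ x * max (m ‖q + P‖) ((L : ℝ) * ‖q + P‖ - n) :=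
      mul_le_mul (hσmin.2 ⟨x, rfl⟩) (le_max_left _ _) (hmpos _ (norm_nonneg _)).le (hσpos x).le
    linarith [hcle n]
  · have h1 : (L : ℝ) * ‖p‖ ≤ L * max R 0 := mul_le_mul_of_nonneg_left hp L.2
    have h2 := hmpos _ (norm_nonneg p)
    rw [max_eq_left (by linarith)]

/-- Value of the generalized effective Hamiltonian at the origin,
`H̄_∞(0) = σ̄ m₀`; and if `σ̄ m₀ < σ̲` then `0 ∈ D` and the open ball
`B(0, (σ̲ − σ̄ m₀)/(σ̄ L))` is contained in the solvability set `D`. -/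
theorem value_at_origin_and_ball_in_solvability_set {N : ℕ} (hN : 1 ≤ N)
    (σ : Euc N → ℝ) (m : ℝ → ℝ) (L : NNReal)
    (hσc : Continuous σ) (hσp : IsZPeriodic σ) (hσpos : ∀ x, 0 < σ x)
    (hm01 : ∀ r : ℝ, 0 ≤ r → 0 < m r ∧ m r < 1)
    (hmLip : LipschitzOnWith L m (Set.Ici 0))
    (hmmono : StrictMonoOn m (Set.Ici 0))
    (hmlim : Tendsto m atTop (nhds 1))
    (σmax σmin : ℝ)
    (hσmax : IsGreatest (Set.range σ) σmax) (hσmin : IsLeast (Set.range σ) σmin)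
    (c : ℕ → Euc N → ℝ)
    (hc : ∀ (n : ℕ) (P : Euc N), ∃ u : Euc N → ℝ,
        IsCellSolution (fun x p => σ x * max (m ‖p‖) ((L : ℝ) * ‖p‖ - n)) P u (c n P))
    (Hinf : Euc N → ℝ)
    (hHinf : ∀ P : Euc N, Tendsto (fun n => c n P) atTop (nhds (Hinf P))) :
    Hinf 0 = σmax * m 0 ∧
    (σmax * m 0 < σmin →
      (∃ (u : Euc N → ℝ) (a : ℝ),
          IsCellSolution (fun x p => σ x * m ‖p‖) (0 : Euc N) u a) ∧
      ∀ P : Euc N, ‖P‖ < (σmin - σmax * m 0) / (σmax * (L : ℝ)) →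
        ∃ (u : Euc N → ℝ) (a : ℝ),
          IsCellSolution (fun x p => σ x * m ‖p‖) P u a) := by
  have hmax : ∀ x, σ x ≤ σmax := fun x => hσmax.2 ⟨x, rfl⟩
  have hm0 : 0 < m 0 := (hm01 0 le_rfl).1
  have hσmaxpos : 0 < σmax := by
    obtain ⟨x, rfl⟩ := hσmax.1
    exact hσpos x
  have hc0 : ∀ n, c n 0 = σmax * m 0 := by
    intro n
    obtain ⟨u, hu⟩ := hc n 0
    apply le_antisymm
    · obtain ⟨x, hx⟩ := hu.exists_le
      refine hx.trans (mul_le_mul (hmax x) ?_ ?_ hσmaxpos.le)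
      · rw [norm_zero]
        refine max_le le_rfl ?_
        linarith [(Nat.cast_nonneg n : (0 : ℝ) ≤ n)]
      · exact (hm01 _ (norm_nonneg _)).1.le.trans (le_max_left _ _)
    · obtain ⟨x, hx⟩ := hσmax.1
      rw [← hx]
      refine hu.le_of_forall_le (f := fun y => σ y * m 0)
        (fun y z => by simp only [hσp y z]) (hσc.mul continuous_const) (fun y p => ?_) x
      exact mul_le_mul_of_nonneg_left ((hmmono.monotoneOn (le_refl (0 : ℝ)) (norm_nonneg p)
        (norm_nonneg p)).trans (le_max_left _ _)) (hσpos y).le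
  refine ⟨tendsto_nhds_unique (hHinf 0) (by simp [hc0]), fun hlt => ?_⟩
  have hsolve : ∀ P : Euc N, σmax * (m 0 + L * ‖P‖) < σmin → ∃ (u : Euc N → ℝ) (a : ℝ),
      IsCellSolution (fun x p => σ x * m ‖p‖) P u a := fun P hP =>
    exists_isCellSolution_of_lt hσpos (fun r hr => (hm01 r hr).1) hmLip hmlim hmax hσmin
      (fun n => hc n P) hP
  refine ⟨hsolve 0 (by simpa using hlt), fun P hP => hsolve P ?_⟩
  have hL : 0 < σmax * (L : ℝ) := by
    refine (mul_nonneg hσmaxpos.le L.2).lt_of_ne fun h => ?_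
    rw [show σmax * (L : ℝ) = 0 from h.symm, div_zero] at hP
    exact (norm_nonneg P).not_gt hP
  rw [lt_div_iff₀ hL] at hP
  linarith
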